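/- arXiv:1912.03222 — 7 statements merged into one kernel-verified Lean document; each statement's English description precedes it below -/
import Mathlib

section
/- For every prime p and every positive integer n, the general linear group GL_n(𝔽_p) contains an element of order p^n − 1. -/
/-- For every prime `p` and every positive integer `n`, the general linear group
`GL n (𝔽_p)` contains an element of order `p ^ n - 1` (a Singer cycle). -/
theorem singer_cycle_exists (p n : ℕ) (hp : p.Prime) (hn : 0 < n) :
    ∃ x : GL (Fin n) (ZMod p), orderOf x = p ^ n - 1 := by
  haveI : Fact p.Prime := ⟨hp⟩
  have hfr := GaloisField.finrank p hn.ne'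
  let b := Module.finBasisOfFinrankEq (ZMod p) (GaloisField p n) hfr
  obtain ⟨g, hg⟩ := IsCyclic.exists_generator (α := (GaloisField p n)ˣ)
  have hord : orderOf g = p ^ n - 1 := by
    rw [orderOf_eq_card_of_forall_mem_zpowers hg, Nat.card_units, GaloisField.card p n hn.ne']
  let f : GaloisField p n →* Matrix (Fin n) (Fin n) (ZMod p) := (Algebra.leftMulMatrix b : _ →* _)
  have hf : Function.Injective f := Algebra.leftMulMatrix_injective b
  refine ⟨Units.map f g, ?_⟩
  rw [← hord]
  exact orderOf_injective (Units.map f) (Units.map_injective hf) g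
end

section
/- For every prime p, every positive integer n, and every element x of GL_n(𝔽_p), the order of x is at most p^n − 1; in particular, the Singer cycles are precisely the elements of maximal order in GL_n(𝔽_p). -/
lemma exists_singer_cycle (p n : ℕ) [Fact p.Prime] (hn : 0 < n) :
    ∃ x : GL (Fin n) (ZMod p), orderOf x = p ^ n - 1 := by
  classical
  let b := Module.finBasisOfFinrankEq (ZMod p) (GaloisField p n) (GaloisField.finrank p hn.ne')
  obtain ⟨g, hg⟩ := IsCyclic.exists_generator (α := (GaloisField p n)ˣ)
  have hcard : orderOf g = p ^ n - 1 := by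
    rw [orderOf_eq_card_of_forall_mem_zpowers hg, Nat.card_units, GaloisField.card p n hn.ne']
  let φ : (GaloisField p n) →* Matrix (Fin n) (Fin n) (ZMod p) :=
    (Algebra.leftMulMatrix b : GaloisField p n →ₐ[ZMod p] _)
  have hφ : Function.Injective φ := Algebra.leftMulMatrix_injective b
  exact ⟨Units.map φ g, (orderOf_injective (Units.map φ) (Units.map_injective hφ) g).trans hcard⟩

lemma orderOf_le_singer (p n : ℕ) [Fact p.Prime] (hn : 0 < n) (x : GL (Fin n) (ZMod p)) :
    orderOf x ≤ p ^ n - 1 := by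
  classical
  haveI : Nonempty (Fin n) := ⟨⟨0, hn⟩⟩
  let M : Matrix (Fin n) (Fin n) (ZMod p) := x
  have key : ∀ k : ℕ, ∃ c : Fin n → ZMod p, M ^ k = ∑ i, c i • M ^ (i : ℕ) := by
    intro k
    refine ⟨fun i => (Polynomial.X ^ k %ₘ M.charpoly).coeff i, ?_⟩
    have hdeg : (Polynomial.X ^ k %ₘ M.charpoly).natDegree < n := by
      have h1 := Polynomial.natDegree_modByMonic_lt (Polynomial.X ^ k) M.charpoly_monic (by
        intro h
        have := M.charpoly_natDegree_eq_dim
        rw [h] at this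
        simp at this
        omega)
      rwa [M.charpoly_natDegree_eq_dim, Fintype.card_fin] at h1
    rw [Matrix.pow_eq_aeval_mod_charpoly, Polynomial.aeval_eq_sum_range' hdeg,
      Finset.sum_range]
  choose c hc using key
  have hle : (Finset.range (orderOf x)).card ≤
      ((Finset.univ : Finset (Fin n → ZMod p)).erase 0).card := by
    refine Finset.card_le_card_of_injOn c ?_ ?_
    · intro k _
      simp only [Finset.coe_erase, Finset.coe_univ, Set.mem_diff, Set.mem_univ, true_and,
        Set.mem_singleton_iff]
      intro h0
      have h1 := hc k
      rw [h0] at h1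
      simp only [Pi.zero_apply, zero_smul, Finset.sum_const_zero] at h1
      exact (x ^ k).ne_zero (by simpa [M] using h1)
    · intro i hi j hj hij
      have h1 : M ^ i = M ^ j := by rw [hc i, hc j, hij]
      have h2 : x ^ i = x ^ j := Units.ext (by simpa [M] using h1)
      exact pow_injOn_Iio_orderOf (by simpa using hi) (by simpa using hj) h2
  simpa [Finset.card_erase_of_mem, ZMod.card] using hle

/-- For every prime `p`, positive integer `n`, and `x ∈ GL n (𝔽_p)`, the order of `x`
is at most `p ^ n - 1`; in particular the Singer cycles (elements of order `p ^ n - 1`)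
are precisely the elements of maximal order in `GL n (𝔽_p)`. -/
theorem singer_cycles_max_order (p n : ℕ) (hp : p.Prime) (hn : 0 < n) :
    (∀ x : GL (Fin n) (ZMod p), orderOf x ≤ p ^ n - 1) ∧
    (∀ x : GL (Fin n) (ZMod p),
      orderOf x = p ^ n - 1 ↔ ∀ y : GL (Fin n) (ZMod p), orderOf y ≤ orderOf x) := by
  haveI : Fact p.Prime := ⟨hp⟩
  refine ⟨orderOf_le_singer p n hn, fun x => ⟨fun h y => ?_, fun h => ?_⟩⟩
  · rw [h]
    exact orderOf_le_singer p n hn y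
  · obtain ⟨y, hy⟩ := exists_singer_cycle p n hn
    exact le_antisymm (orderOf_le_singer p n hn x) (hy ▸ h y)
end

section
/- Let p be a prime and n a positive integer. If x and y are elements of GL_n(𝔽_p) both of order p^n − 1, then the cyclic subgroups ⟨x⟩ and ⟨y⟩ are conjugate in GL_n(𝔽_p), i.e. there exists g ∈ GL_n(𝔽_p) with g⟨x⟩g⁻¹ = ⟨y⟩. -/
theorem singer_aux_set (p n : ℕ) [Fact p.Prime] (hn : 0 < n)
    (x : GL (Fin n) (ZMod p)) (hx : orderOf x = p ^ n - 1) :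
    Nat.card (Algebra.adjoin (ZMod p) {(x : Matrix (Fin n) (Fin n) (ZMod p))}) = p ^ n ∧
    ∀ a ∈ Algebra.adjoin (ZMod p) {(x : Matrix (Fin n) (Fin n) (ZMod p))}, a ≠ 0 →
      ∃ u ∈ Subgroup.zpowers x, (u : Matrix (Fin n) (Fin n) (ZMod p)) = a := by
  have : NeZero n := ⟨hn.ne'⟩
  set X : Matrix (Fin n) (Fin n) (ZMod p) := x.val with hX
  set A := Algebra.adjoin (ZMod p) {X} with hA
  have hpn : 0 < p ^ n := pow_pos (Fact.out : p.Prime).pos n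
  let T : Set (Matrix (Fin n) (Fin n) (ZMod p)) :=
    insert 0 ((fun u : GL (Fin n) (ZMod p) => (u : Matrix (Fin n) (Fin n) (ZMod p))) ''
      (Subgroup.zpowers x : Set (GL (Fin n) (ZMod p))))
  have hT : T.ncard = p ^ n := by
    have h1 : (0 : Matrix (Fin n) (Fin n) (ZMod p)) ∉
        ((fun u : GL (Fin n) (ZMod p) => (u : Matrix (Fin n) (Fin n) (ZMod p))) ''
      (Subgroup.zpowers x : Set (GL (Fin n) (ZMod p)))) := by
      rintro ⟨u, -, hu⟩
      exact u.ne_zero hu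
    rw [Set.ncard_insert_of_notMem h1 (Set.toFinite _),
      Set.ncard_image_of_injective _ Units.val_injective]
    have : (Subgroup.zpowers x : Set (GL (Fin n) (ZMod p))).ncard = p ^ n - 1 := by
      rw [← hx, ← Nat.card_zpowers, ← Nat.card_coe_set_eq]; rfl
    omega
  have hTA : T ⊆ (A : Set _) := by
    rintro a (rfl | ⟨u, hu, rfl⟩)
    · exact A.zero_mem
    · obtain ⟨k, rfl⟩ := (mem_powers_iff_mem_zpowers (x := x)).2 hu
      simp only [Units.val_pow_eq_pow_val]
      exact A.pow_mem (Algebra.subset_adjoin rfl) k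
  have hcard : (A : Set (Matrix (Fin n) (Fin n) (ZMod p))).ncard ≤ p ^ n := by
    have hsub : (A : Set (Matrix (Fin n) (Fin n) (ZMod p))) ⊆
        Set.range (fun c : Fin n → ZMod p =>
          Polynomial.aeval X ((Polynomial.degreeLTEquiv (ZMod p) n).symm c).1) := by
      intro a ha
      rw [hA, SetLike.mem_coe, Algebra.adjoin_singleton_eq_range_aeval] at ha
      obtain ⟨f, rfl⟩ := ha
      have hd : f %ₘ X.charpoly ∈ Polynomial.degreeLT (ZMod p) n := by
        rw [Polynomial.mem_degreeLT]
        have := Polynomial.degree_modByMonic_lt f X.charpoly_monic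
        rwa [Matrix.charpoly_degree_eq_dim, Fintype.card_fin] at this
      refine ⟨Polynomial.degreeLTEquiv (ZMod p) n ⟨_, hd⟩, ?_⟩
      simp only [LinearEquiv.symm_apply_apply]
      conv_rhs => rw [← Polynomial.modByMonic_add_div f X.charpoly]
      simp [Matrix.aeval_self_charpoly]
    refine (Set.ncard_le_ncard hsub (Set.toFinite _)).trans ?_
    rw [← Set.image_univ]
    refine (Set.ncard_image_le (Set.toFinite _)).trans ?_
    simp [Set.ncard_univ, Nat.card_eq_fintype_card, ZMod.card]
  have hEq : T = (A : Set _) := Set.eq_of_subset_of_ncard_le hTA (by rw [hT]; exact hcard)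
    (Set.toFinite _)
  refine ⟨?_, ?_⟩
  · rw [← hT, hEq, ← Nat.card_coe_set_eq]; rfl
  · intro a ha h0
    have : a ∈ T := by rw [hEq]; exact ha
    rcases this with h | ⟨u, hu, h⟩
    · exact absurd h h0
    · exact ⟨u, hu, h⟩

theorem singer_aux_field (p n : ℕ) [Fact p.Prime] (hn : 0 < n)
    (x : GL (Fin n) (ZMod p)) (hx : orderOf x = p ^ n - 1) :
    ∃ (K : Type) (_ : Field K) (_ : Fintype K) (f : K →+* Matrix (Fin n) (Fin n) (ZMod p)),
      Fintype.card K = p ^ n ∧ (∃ a, f a = x) ∧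
      ∀ a ≠ 0, ∃ u ∈ Subgroup.zpowers x, (u : Matrix (Fin n) (Fin n) (ZMod p)) = f a := by
  have : NeZero n := ⟨hn.ne'⟩
  obtain ⟨h1, h2⟩ := singer_aux_set p n hn x hx
  set A := Algebra.adjoin (ZMod p) {(x : Matrix (Fin n) (Fin n) (ZMod p))} with hA
  have hxA : (x : Matrix (Fin n) (Fin n) (ZMod p)) ∈ A := Algebra.subset_adjoin rfl
  have hF : IsField A := by
    refine ⟨⟨0, 1, zero_ne_one⟩, ?_, ?_⟩
    · have := Algebra.isMulCommutative_adjoin (ZMod p)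
        (s := {(x : Matrix (Fin n) (Fin n) (ZMod p))}) (by simp)
      exact fun a b => mul_comm' a b
    · intro a ha
      obtain ⟨u, hu, hua⟩ := h2 a a.2 (by simpa using ha)
      obtain ⟨k, hk⟩ := (mem_powers_iff_mem_zpowers (x := x)).2 ((Subgroup.zpowers x).inv_mem hu)
      refine ⟨⟨(x : Matrix (Fin n) (Fin n) (ZMod p)) ^ k, A.pow_mem hxA k⟩, ?_⟩
      apply Subtype.ext
      have : (x : Matrix (Fin n) (Fin n) (ZMod p)) ^ k = (u⁻¹ : GL (Fin n) (ZMod p)) := by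
        rw [← hk]; simp
      simp only [MulMemClass.coe_mul, this, ← hua, OneMemClass.coe_one]
      exact u.mul_inv
  refine ⟨A, hF.toField, Fintype.ofFinite A, A.toSubring.subtype, ?_, ⟨⟨_, hxA⟩, rfl⟩, ?_⟩
  · rw [← h1]; exact (@Nat.card_eq_fintype_card _ (Fintype.ofFinite A)).symm
  · intro a ha
    exact h2 a a.2 (fun h => ha (Subtype.ext h))

/-- The linear identification of the field with the space, by evaluation at a nonzero vector. -/
theorem singer_aux_eval (p n : ℕ) [Fact p.Prime] (hn : 0 < n) (K : Type) [Field K] [Fintype K]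
    (f : K →+* Matrix (Fin n) (Fin n) (ZMod p)) (hK : Fintype.card K = p ^ n) :
    ∃ e : K ≃+ (Fin n → ZMod p), ∀ a b, e (a * b) = Matrix.mulVec (f a) (e b) := by
  have : NeZero n := ⟨hn.ne'⟩
  let v : Fin n → ZMod p := Pi.single 0 1
  have hv : v ≠ 0 := by
    intro h
    have := congrFun h 0
    simp [v] at this
  let e : K →+ (Fin n → ZMod p) :=
    { toFun := fun a => Matrix.mulVec (f a) v
      map_zero' := by simp
      map_add' := by intro a b; simp [Matrix.add_mulVec] }
  have hinj : Function.Injective e := by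
    rw [injective_iff_map_eq_zero]
    intro a ha
    by_contra h0
    apply hv
    have h3 : Matrix.mulVec (f a⁻¹) (Matrix.mulVec (f a) v) = 0 := by
      have : Matrix.mulVec (f a) v = 0 := ha
      rw [this, Matrix.mulVec_zero]
    rwa [Matrix.mulVec_mulVec, ← map_mul, inv_mul_cancel₀ h0, map_one, Matrix.one_mulVec] at h3
  have hbij : Function.Bijective e := by
    rw [Fintype.bijective_iff_injective_and_card]
    exact ⟨hinj, by simp [hK, ZMod.card]⟩
  refine ⟨AddEquiv.ofBijective e hbij, fun a b => ?_⟩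
  change Matrix.mulVec (f (a * b)) v = Matrix.mulVec (f a) (Matrix.mulVec (f b) v)
  rw [Matrix.mulVec_mulVec, map_mul]

/-- Subgroups of `GL n (𝔽_p)` generated by Singer cycles are conjugate. -/
theorem singer_subgroups_conjugate (p n : ℕ) (hp : p.Prime) (hn : 0 < n)
    (x y : GL (Fin n) (ZMod p))
    (hx : orderOf x = p ^ n - 1) (hy : orderOf y = p ^ n - 1) :
    ∃ g : GL (Fin n) (ZMod p),
      (Subgroup.zpowers x).map (MulAut.conj g).toMonoidHom = Subgroup.zpowers y := by
  have : Fact p.Prime := ⟨hp⟩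
  obtain ⟨K, _, _, f, hK, ⟨a, ha⟩, -⟩ := singer_aux_field p n hn x hx
  obtain ⟨L, _, _, f', hL, -, hL2⟩ := singer_aux_field p n hn y hy
  obtain ⟨e, he⟩ := singer_aux_eval p n hn K f hK
  obtain ⟨e', he'⟩ := singer_aux_eval p n hn L f' hL
  let φ : K ≃+* L := FiniteField.ringEquivOfCardEq (hK.trans hL.symm)
  let g₀ : (Fin n → ZMod p) ≃+ (Fin n → ZMod p) := (e.symm.trans φ.toAddEquiv).trans e'
  let g₁ : (Fin n → ZMod p) ≃ₗ[ZMod p] (Fin n → ZMod p) :=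
    { g₀ with map_smul' := fun c v => ZMod.map_smul g₀.toAddMonoidHom c v }
  let g : GL (Fin n) (ZMod p) := Matrix.GeneralLinearGroup.toLin.symm
    (LinearMap.GeneralLinearGroup.ofLinearEquiv g₁)
  have hg : ∀ v, Matrix.mulVec (g : Matrix (Fin n) (Fin n) (ZMod p)) v = e' (φ (e.symm v)) := by
    intro v
    exact congrFun (congrArg DFunLike.coe (Matrix.toLin'_toMatrix' g₁.toLinearMap)) v
  have ha0 : a ≠ 0 := by
    have : NeZero n := ⟨hn.ne'⟩
    rintro rfl
    rw [map_zero] at ha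
    exact x.ne_zero ha.symm
  obtain ⟨u, hu, hua⟩ := hL2 (φ a) (by simpa using ha0)
  have hconj : g * x = u * g := by
    apply Units.ext
    rw [Units.val_mul, Units.val_mul, hua, ← ha]
    apply Matrix.toLin'.injective
    apply LinearMap.ext
    intro v
    rw [Matrix.toLin'_apply, Matrix.toLin'_apply, ← Matrix.mulVec_mulVec, ← Matrix.mulVec_mulVec,
      hg, hg, ← he', ← map_mul φ]
    congr 2
    rw [AddEquiv.symm_apply_eq, he, AddEquiv.apply_symm_apply]
  have hc : (MulAut.conj g).toMonoidHom x = u := by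
    change g * x * g⁻¹ = u
    rw [hconj, mul_inv_cancel_right]
  refine ⟨g, ?_⟩
  apply Subgroup.eq_of_le_of_card_ge
  · rw [MonoidHom.map_zpowers, hc, Subgroup.zpowers_le]
    exact hu
  · rw [Subgroup.card_map_of_injective (MulAut.conj g).injective, Nat.card_zpowers,
      Nat.card_zpowers, hx, hy]
end

section
/- Let p be a prime, n a positive integer, and x an element of GL_n(𝔽_p) of order p^n − 1. Then the cyclic group X = ⟨x⟩ acts regularly on the nonzero vectors of the vector space 𝔽_p^n: for any two nonzero vectors v, w ∈ 𝔽_p^n there is an element g ∈ X with g·v = w, and the only element of X fixing a nonzero vector is the identity. -/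
open Polynomial in
/-- Every polynomial in a Singer cycle is zero or a power of it. -/
theorem singer_poly_aux (p n : ℕ) (hp : p.Prime) (hn : 0 < n)
    (x : GL (Fin n) (ZMod p)) (hx : orderOf x = p ^ n - 1) (q : (ZMod p)[X])
    (hq : aeval (x : Matrix (Fin n) (Fin n) (ZMod p)) q ≠ 0) :
    ∃ g ∈ Subgroup.zpowers x, (g : Matrix (Fin n) (Fin n) (ZMod p)) = aeval (x : Matrix (Fin n) (Fin n) (ZMod p)) q := by
  classical
  haveI : Fact p.Prime := ⟨hp⟩
  haveI : Nonempty (Fin n) := ⟨⟨0, hn⟩⟩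
  set M : Matrix (Fin n) (Fin n) (ZMod p) := x.val with hM
  let L : (Fin n → ZMod p) → Matrix (Fin n) (Fin n) (ZMod p) :=
    fun c => aeval M ((degreeLTEquiv (ZMod p) n).symm c : (ZMod p)[X])
  have hL : ∀ r : (ZMod p)[X], aeval M r ∈ Set.range L := by
    intro r
    rw [Matrix.aeval_eq_aeval_mod_charpoly]
    have hd : r %ₘ M.charpoly ∈ degreeLT (ZMod p) n := by
      rw [mem_degreeLT]
      have h1 := degree_modByMonic_lt r M.charpoly_monic
      rwa [Matrix.charpoly_degree_eq_dim, Fintype.card_fin] at h1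
    exact ⟨degreeLTEquiv (ZMod p) n ⟨_, hd⟩, by simp [L]⟩
  let S : Set (Matrix (Fin n) (Fin n) (ZMod p)) :=
    (fun g : GL (Fin n) (ZMod p) => (g : Matrix (Fin n) (Fin n) (ZMod p))) '' (Subgroup.zpowers x : Set _)
  have hScard : S.ncard = p ^ n - 1 := by
    rw [Set.ncard_image_of_injective _ Units.val_injective, ← hx, ← Nat.card_zpowers]
    rfl
  have h0 : (0 : Matrix (Fin n) (Fin n) (ZMod p)) ∉ S := by
    rintro ⟨g, -, hg⟩
    exact g.ne_zero hg
  have hsub : insert 0 S ⊆ Set.range L := by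
    rintro y (rfl | ⟨g, hg, rfl⟩)
    · simpa using hL 0
    · obtain ⟨k, rfl⟩ := (mem_powers_iff_mem_zpowers.mpr hg)
      simpa using hL (X ^ k)
  have hcard : (Set.range L).ncard ≤ (insert 0 S).ncard := by
    rw [Set.ncard_insert_of_notMem h0 (Set.toFinite _), hScard, Nat.sub_add_cancel (Nat.one_le_pow _ _ hp.pos)]
    rw [← Set.image_univ]
    refine (Set.ncard_image_le (Set.toFinite _)).trans ?_
    simp [Set.ncard_univ]
  have heq := Set.eq_of_subset_of_ncard_le hsub hcard (Set.toFinite _)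
  have := hL q
  rw [← heq] at this
  rcases this with h | ⟨g, hg, h⟩
  · exact absurd h hq
  · exact ⟨g, hg, h⟩


/-- A Singer cycle subgroup of `GL n (𝔽_p)` acts regularly on the nonzero vectors
of `𝔽_p ^ n`: it acts transitively on them, and only the identity fixes a nonzero
vector. -/
theorem singer_acts_regularly (p n : ℕ) (hp : p.Prime) (hn : 0 < n)
    (x : GL (Fin n) (ZMod p)) (hx : orderOf x = p ^ n - 1) :
    (∀ v w : Fin n → ZMod p, v ≠ 0 → w ≠ 0 →
      ∃ g ∈ Subgroup.zpowers x,
        (g : Matrix (Fin n) (Fin n) (ZMod p)).mulVec v = w) ∧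
    (∀ g ∈ Subgroup.zpowers x, ∀ v : Fin n → ZMod p, v ≠ 0 →
      (g : Matrix (Fin n) (Fin n) (ZMod p)).mulVec v = v → g = 1) := by
  classical
  haveI : Fact p.Prime := ⟨hp⟩
  have free : ∀ g ∈ Subgroup.zpowers x, ∀ v : Fin n → ZMod p, v ≠ 0 →
      (g : Matrix (Fin n) (Fin n) (ZMod p)).mulVec v = v → g = 1 := by
    intro g hg v hv h
    obtain ⟨k, rfl⟩ := (mem_powers_iff_mem_zpowers.mpr hg)
    by_contra hne
    obtain ⟨u, -, hu⟩ := singer_poly_aux p n hp hn x hx (Polynomial.X ^ k - 1) (by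
      intro h0
      apply hne
      ext1
      simpa [sub_eq_zero] using h0)
    have h1 : (u : Matrix (Fin n) (Fin n) (ZMod p)).mulVec v = 0 := by
      rw [hu]
      simp only [map_sub, map_pow, Polynomial.aeval_X, map_one, Matrix.sub_mulVec, Matrix.one_mulVec]
      rw [sub_eq_zero]
      simpa using h
    apply hv
    have h2 := congrArg ((u⁻¹ : GL (Fin n) (ZMod p)) : Matrix (Fin n) (Fin n) (ZMod p)).mulVec h1
    rwa [Matrix.mulVec_mulVec, Units.inv_mul, Matrix.one_mulVec, Matrix.mulVec_zero] at h2
  refine ⟨?_, free⟩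
  intro v w hv hw
  let f : GL (Fin n) (ZMod p) → (Fin n → ZMod p) :=
    fun g => (g : Matrix (Fin n) (Fin n) (ZMod p)).mulVec v
  have hinj : Set.InjOn f (Subgroup.zpowers x : Set _) := by
    intro a ha b hb hab
    have h1 : b⁻¹ * a = 1 := by
      refine free _ (mul_mem (inv_mem hb) ha) v hv ?_
      rw [Units.val_mul, ← Matrix.mulVec_mulVec]
      change Matrix.mulVec _ (f a) = v
      rw [hab]
      simp only [f]
      rw [Matrix.mulVec_mulVec, Units.inv_mul, Matrix.one_mulVec]
    exact (inv_mul_eq_one.mp h1).symm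
  have hc : (f '' (Subgroup.zpowers x : Set _)).ncard = p ^ n - 1 := by
    rw [Set.ncard_image_of_injOn hinj, ← hx, ← Nat.card_zpowers]
    rfl
  have hsub : f '' (Subgroup.zpowers x : Set _) ⊆ {0}ᶜ := by
    rintro _ ⟨g, -, rfl⟩ h0
    apply hv
    have h2 := congrArg ((g⁻¹ : GL (Fin n) (ZMod p)) : Matrix (Fin n) (Fin n) (ZMod p)).mulVec
      (show (g : Matrix (Fin n) (Fin n) (ZMod p)).mulVec v = 0 from h0)
    rwa [Matrix.mulVec_mulVec, Units.inv_mul, Matrix.one_mulVec, Matrix.mulVec_zero] at h2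
  have heq := Set.eq_of_subset_of_ncard_le hsub (by
    rw [hc, Set.ncard_compl, Set.ncard_singleton]
    simp) (Set.toFinite _)
  have hw' : w ∈ ({0}ᶜ : Set (Fin n → ZMod p)) := hw
  rw [← heq] at hw'
  exact hw'
end

section
/- Let p be a prime, n a positive integer, and x an element of GL_n(𝔽_p) of order p^n − 1. Then x acts irreducibly on 𝔽_p^n: every 𝔽_p-subspace W of 𝔽_p^n satisfying x·W ⊆ W is either the zero subspace or all of 𝔽_p^n. -/
/-- A Singer cycle `x ∈ GL n (𝔽_p)` acts irreducibly on `𝔽_p ^ n`: any subspace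
invariant under `x` is zero or everything. -/
theorem singer_acts_irreducibly (p n : ℕ) (hp : p.Prime) (hn : 0 < n)
    (x : GL (Fin n) (ZMod p)) (hx : orderOf x = p ^ n - 1)
    (W : Submodule (ZMod p) (Fin n → ZMod p))
    (hW : ∀ v ∈ W, (x : Matrix (Fin n) (Fin n) (ZMod p)).mulVec v ∈ W) :
    W = ⊥ ∨ W = ⊤ := by
  classical
  have : Fact p.Prime := ⟨hp⟩
  have : Nonempty (Fin n) := ⟨⟨0, hn⟩⟩
  have hpos : 0 < p ^ n := pow_pos hp.pos n
  by_cases hbot : W = ⊥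
  · exact Or.inl hbot
  right
  obtain ⟨v, hv, hv0⟩ := W.ne_bot_iff.1 hbot
  set M : Matrix (Fin n) (Fin n) (ZMod p) := x.val with hM
  have hpow : ∀ i, M ^ i = ((x ^ i : GL (Fin n) (ZMod p)) : Matrix _ _ _) := fun i => by
    simp [hM]
  have hinvt : ∀ i (w : Fin n → ZMod p), (M ^ i).mulVec w = 0 → w = 0 := by
    intro i w h
    rw [hpow] at h
    have := congrArg ((x ^ i)⁻¹ : GL (Fin n) (ZMod p)).val.mulVec h
    rw [Matrix.mulVec_mulVec, Units.inv_mul, Matrix.one_mulVec, Matrix.mulVec_zero] at this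
    exact this
  have hMinj : ∀ i < p ^ n - 1, ∀ j < p ^ n - 1, M ^ i = M ^ j → i = j := by
    intro i hi j hj h
    rw [hpow, hpow] at h
    have heq := Units.ext h
    exact pow_injOn_Iio_orderOf (by simpa [hx] using hi) (by simpa [hx] using hj) heq
  let S : Finset (Matrix (Fin n) (Fin n) (ZMod p)) :=
    Finset.univ.image (fun c : Fin n → ZMod p => ∑ i : Fin n, c i • M ^ (i : ℕ))
  have hScard : S.card ≤ p ^ n := by
    refine Finset.card_image_le.trans ?_
    simp [ZMod.card]
  have hS : ∀ f : Polynomial (ZMod p), Polynomial.aeval M f ∈ S := by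
    intro f
    have hmon := M.charpoly_monic
    have h1 : Polynomial.aeval M f = Polynomial.aeval M (f %ₘ M.charpoly) := by
      conv_lhs => rw [← Polynomial.modByMonic_add_div f M.charpoly]
      simp [Matrix.aeval_self_charpoly]
    have hdeg : (f %ₘ M.charpoly).natDegree < n := by
      have := Polynomial.natDegree_modByMonic_lt f hmon (by
        intro h
        have := M.charpoly_natDegree_eq_dim
        rw [h] at this
        simp at this
        omega)
      rwa [M.charpoly_natDegree_eq_dim, Fintype.card_fin] at this
    rw [h1, Polynomial.aeval_eq_sum_range' hdeg, Finset.sum_range]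
    exact Finset.mem_image.2 ⟨fun i => (f %ₘ M.charpoly).coeff i, Finset.mem_univ _, rfl⟩
  let T : Finset (Matrix (Fin n) (Fin n) (ZMod p)) :=
    insert 0 ((Finset.range (p ^ n - 1)).image (fun i => M ^ i))
  have hTcard : T.card = p ^ n := by
    rw [Finset.card_insert_of_notMem, Finset.card_image_of_injOn, Finset.card_range]
    · omega
    · intro i hi j hj h
      exact hMinj i (by simpa using hi) j (by simpa using hj) h
    · intro h
      obtain ⟨i, -, hi⟩ := Finset.mem_image.1 h
      exact hv0 (hinvt i v (by rw [hi, Matrix.zero_mulVec]))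
  have hTS : T ⊆ S := by
    intro A hA
    rcases Finset.mem_insert.1 hA with rfl | hA
    · simpa using hS 0
    · obtain ⟨i, -, rfl⟩ := Finset.mem_image.1 hA
      simpa using hS (Polynomial.X ^ i)
  have hEq : T = S := Finset.eq_of_subset_of_card_le hTS (by omega)
  have hvinj : ∀ i < p ^ n - 1, ∀ j < p ^ n - 1,
      (M ^ i).mulVec v = (M ^ j).mulVec v → i = j := by
    intro i hi j hj h
    have hmem : M ^ i - M ^ j ∈ T := by
      rw [hEq]
      have h2 := hS (Polynomial.X ^ i - Polynomial.X ^ j)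
      rwa [map_sub, map_pow, map_pow, Polynomial.aeval_X] at h2
    rcases Finset.mem_insert.1 hmem with h0 | h0
    · exact hMinj i hi j hj (sub_eq_zero.1 h0)
    · obtain ⟨k, -, hk⟩ := Finset.mem_image.1 h0
      refine absurd (hinvt k v ?_) hv0
      rw [hk, Matrix.sub_mulVec, h, sub_self]
  let U : Finset (Fin n → ZMod p) :=
    insert 0 ((Finset.range (p ^ n - 1)).image (fun i => (M ^ i).mulVec v))
  have hUcard : U.card = p ^ n := by
    rw [Finset.card_insert_of_notMem, Finset.card_image_of_injOn, Finset.card_range]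
    · omega
    · intro i hi j hj h
      exact hvinj i (by simpa using hi) j (by simpa using hj) h
    · intro h
      obtain ⟨i, -, hi⟩ := Finset.mem_image.1 h
      exact hv0 (hinvt i v hi)
  have hUuniv : U = Finset.univ := by
    apply Finset.eq_univ_of_card
    rw [hUcard]
    simp [ZMod.card]
  have hWpow : ∀ i, (M ^ i).mulVec v ∈ W := by
    intro i
    induction i with
    | zero => simpa using hv
    | succ k ih =>
      rw [pow_succ', ← Matrix.mulVec_mulVec]
      exact hW _ ih
  rw [Submodule.eq_top_iff']
  intro w
  have hw : w ∈ U := by rw [hUuniv]; exact Finset.mem_univ _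
  rcases Finset.mem_insert.1 hw with rfl | hw
  · exact W.zero_mem
  · obtain ⟨i, -, rfl⟩ := Finset.mem_image.1 hw
    exact hWpow i
end

section
/- Let p be a prime, n a positive integer, and x an element of GL_n(𝔽_p) of order p^n − 1, and set X = ⟨x⟩. Then the centralizer of X in GL_n(𝔽_p) equals X. -/
open Polynomial in
lemma singer_key (p n : ℕ) [Fact p.Prime] (hn : 0 < n)
    (x : GL (Fin n) (ZMod p)) (hx : orderOf x = p ^ n - 1) (q : (ZMod p)[X]) :
    aeval (x : Matrix (Fin n) (Fin n) (ZMod p)) q = 0 ∨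
    ∃ u ∈ Subgroup.zpowers x, aeval (x : Matrix (Fin n) (Fin n) (ZMod p)) q =
      (u : Matrix (Fin n) (Fin n) (ZMod p)) := by
  classical
  have : Nonempty (Fin n) := ⟨⟨0, hn⟩⟩
  have hp := (Fact.out : p.Prime)
  have hpn : 0 < p ^ n := pow_pos hp.pos n
  set M : Matrix (Fin n) (Fin n) (ZMod p) := x.val with hM
  let g : degreeLT (ZMod p) n → Matrix (Fin n) (Fin n) (ZMod p) := fun c => aeval M c.1
  have hmem : ∀ q : (ZMod p)[X], aeval M q ∈ Set.range g := by
    intro q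
    refine ⟨⟨q %ₘ M.charpoly, ?_⟩, ?_⟩
    · rw [mem_degreeLT]
      refine (degree_modByMonic_lt _ M.charpoly_monic).trans_le ?_
      rw [Matrix.charpoly_degree_eq_dim, Fintype.card_fin]
    · exact (Matrix.aeval_eq_aeval_mod_charpoly M q).symm
  let T : Set (Matrix (Fin n) (Fin n) (ZMod p)) :=
    insert 0 (Set.image (fun u : GL (Fin n) (ZMod p) => u.val) (Subgroup.zpowers x : Set _))
  have hT : T.ncard = p ^ n := by
    rw [Set.ncard_insert_of_notMem, Set.ncard_image_of_injective _ Units.val_injective]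
    · have : (Subgroup.zpowers x : Set (GL (Fin n) (ZMod p))).ncard = p ^ n - 1 := by
        rw [← hx, ← Nat.card_zpowers]; rfl
      omega
    · rintro ⟨u, -, hu⟩
      exact u.ne_zero hu
  have hTR : T ⊆ Set.range g := by
    rintro m (rfl | ⟨u, hu, rfl⟩)
    · simpa using hmem 0
    · obtain ⟨k, -, rfl⟩ := (mem_zpowers_iff_mem_range_orderOf (x := x) (y := u)).1 hu
        |> Finset.mem_image.1
      simpa [hM] using hmem (X ^ k)
  have hR : (Set.range g).ncard ≤ p ^ n := by
    have : Finite (degreeLT (ZMod p) n) := Finite.of_equiv _ (degreeLTEquiv (ZMod p) n).symm.toEquiv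
    have h1 : Nat.card (degreeLT (ZMod p) n) = p ^ n := by
      rw [Nat.card_congr (degreeLTEquiv (ZMod p) n).toEquiv]; simp
    rw [← h1]
    exact Finite.card_range_le g
  have hEq : T = Set.range g := Set.eq_of_subset_of_ncard_le hTR (by omega) (Set.toFinite _)
  have := hmem q
  rw [← hEq] at this
  rcases this with h | ⟨u, hu, h⟩
  · exact Or.inl h
  · exact Or.inr ⟨u, hu, h.symm⟩

/-- The centralizer in `GL n (𝔽_p)` of a Singer cycle subgroup `X = ⟨x⟩` is `X` itself. -/
theorem singer_self_centralizing (p n : ℕ) (hp : p.Prime) (hn : 0 < n)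
    (x : GL (Fin n) (ZMod p)) (hx : orderOf x = p ^ n - 1) :
    Subgroup.centralizer (Subgroup.zpowers x : Set (GL (Fin n) (ZMod p))) =
      Subgroup.zpowers x := by
  classical
  have : Fact p.Prime := ⟨hp⟩
  have : Nonempty (Fin n) := ⟨⟨0, hn⟩⟩
  apply le_antisymm
  · intro y hy
    rw [Subgroup.mem_centralizer_iff] at hy
    obtain ⟨v, hv⟩ := exists_ne (0 : Fin n → ZMod p)
    have hne : ∀ u : GL (Fin n) (ZMod p), ∀ w : Fin n → ZMod p, w ≠ 0 →
        u.val.mulVec w ≠ 0 := by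
      intro u w hw h
      apply hw
      have : (u⁻¹).val.mulVec (u.val.mulVec w) = 0 := by rw [h, Matrix.mulVec_zero]
      rwa [Matrix.mulVec_mulVec, ← Units.val_mul, inv_mul_cancel, Units.val_one,
        Matrix.one_mulVec] at this
    let f : Subgroup.zpowers x → {w : Fin n → ZMod p // w ≠ 0} :=
      fun u => ⟨u.1.val.mulVec v, hne _ _ hv⟩
    have hf : Function.Injective f := by
      rintro ⟨a, ha⟩ ⟨b, hb⟩ hab
      have hab' : a.val.mulVec v = b.val.mulVec v := congrArg Subtype.val hab
      obtain ⟨i, -, rfl⟩ := (mem_zpowers_iff_mem_range_orderOf (x := x) (y := a)).1 ha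
        |> Finset.mem_image.1
      obtain ⟨j, -, rfl⟩ := (mem_zpowers_iff_mem_range_orderOf (x := x) (y := b)).1 hb
        |> Finset.mem_image.1
      have h0 : (Polynomial.aeval x.val (Polynomial.X ^ i - Polynomial.X ^ j :
          Polynomial (ZMod p))).mulVec v = 0 := by
        simpa [Matrix.sub_mulVec, sub_eq_zero] using hab'
      rcases singer_key p n hn x hx (Polynomial.X ^ i - Polynomial.X ^ j) with h | ⟨u, -, h⟩
      · apply Subtype.ext
        apply Units.ext
        simpa [sub_eq_zero] using h
      · rw [h] at h0
        exact absurd h0 (hne u v hv)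
    have hsurj : Function.Surjective f := by
      refine (hf.bijective_of_nat_card_le ?_).2
      rw [Nat.card_zpowers, hx]
      simp [Nat.card_eq_fintype_card, Fintype.card_subtype_compl]
    obtain ⟨⟨u, hu⟩, huv⟩ := hsurj ⟨y.val.mulVec v, hne _ _ hv⟩
    have huv' : u.val.mulVec v = y.val.mulVec v := congrArg Subtype.val huv
    have : y = u := by
      apply Units.ext
      apply Matrix.mulVec_injective
      funext w
      by_cases hw : w = 0
      · simp [hw]
      obtain ⟨⟨t, ht⟩, htw⟩ := hsurj ⟨w, hw⟩
      have htw' : t.val.mulVec v = w := congrArg Subtype.val htw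
      have h1 : t * y = y * t := hy t ht
      have h2 : t * u = u * t := by
        obtain ⟨i, rfl⟩ := ht
        obtain ⟨j, rfl⟩ := hu
        exact zpow_mul_comm x i j
      rw [← htw', Matrix.mulVec_mulVec, Matrix.mulVec_mulVec, ← Units.val_mul, ← Units.val_mul,
        ← h1, ← h2, Units.val_mul, Units.val_mul, ← Matrix.mulVec_mulVec, ← Matrix.mulVec_mulVec,
        huv']
    rwa [this]
  · intro y hy
    rw [Subgroup.mem_centralizer_iff]
    rintro t ⟨i, rfl⟩
    obtain ⟨j, rfl⟩ := hy
    exact zpow_mul_comm x i j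
end

section
/- Let t, k ≥ 2 be integers and let n = t·k. If G is a finite group with a normal subgroup N such that the exponent of N divides 2^k − 1 and the exponent of the quotient G/N divides t, then G contains no element of order 2^n − 1; in particular, there is no injective group homomorphism from the cyclic group of order 2^n − 1 into the wreath product C_{2^k−1} ≀ C_t. -/
/-- Strict Bernoulli inequality over the naturals. -/
theorem strict_bernoulli_aux (b t : ℕ) (hb : 1 ≤ b) (ht : 2 ≤ t) :
    t * b + 1 < (b + 1) ^ t := by
  induction t, ht using Nat.le_induction with
  | base => nlinarith
  | succ m hm ih =>
    rw [pow_succ]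
    nlinarith [Nat.zero_le (m * b * b)]

/-- Let `n = t * k` with `t, k ≥ 2`. A finite group `G` with a normal subgroup `N` whose
exponent divides `2 ^ k - 1` and whose quotient `G / N` has exponent dividing `t` contains
no element of order `2 ^ n - 1`; in particular there is no embedding of `C_{2^n - 1}` into
the wreath product `C_{2^k - 1} ≀ C_t`. -/
theorem no_singer_in_wreath (t k n : ℕ) (ht : 2 ≤ t) (hk : 2 ≤ k) (hn : n = t * k)
    (G : Type*) [Group G] [Finite G] (N : Subgroup G) [N.Normal]
    (hNexp : Monoid.exponent N ∣ 2 ^ k - 1)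
    (hQexp : Monoid.exponent (G ⧸ N) ∣ t) :
    (∀ g : G, orderOf g ≠ 2 ^ n - 1) ∧
    (∀ f : Multiplicative (ZMod (2 ^ n - 1)) →* G, ¬ Function.Injective f) := by
  have key : ∀ g : G, orderOf g ≠ 2 ^ n - 1 := by
    intro g hg
    have h1 : g ^ t ∈ N := by
      rw [← QuotientGroup.eq_one_iff, QuotientGroup.mk_pow]
      exact Monoid.exponent_dvd_iff_forall_pow_eq_one.mp hQexp _
    have h2 : (g ^ t) ^ (2 ^ k - 1) = 1 := by
      have h := Monoid.exponent_dvd_iff_forall_pow_eq_one.mp hNexp ⟨g ^ t, h1⟩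
      simpa using congrArg Subtype.val h
    rw [← pow_mul] at h2
    have h3 := orderOf_dvd_of_pow_eq_one h2
    have h4 : 2 ^ 2 ≤ 2 ^ k := Nat.pow_le_pow_right (by norm_num) hk
    have h5 := Nat.le_of_dvd (Nat.mul_pos (by omega) (by omega)) h3
    have h6 := strict_bernoulli_aux (2 ^ k - 1) t (by omega) ht
    have h7 : 2 ^ k - 1 + 1 = 2 ^ k := by omega
    rw [h7, ← pow_mul, mul_comm k t, ← hn] at h6
    omega
  refine ⟨key, fun f hf => ?_⟩
  apply key (f (Multiplicative.ofAdd 1))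
  rw [orderOf_injective f hf, orderOf_ofAdd_eq_addOrderOf, ZMod.addOrderOf_one]
end
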